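/- Let Ω = (a,b)×(c,d) with a < b and c < d. If v : ℝ² → ℝ is four times continuously differentiable and vanishes on ∂Ω, then ∫_Ω (Δv) · v_xxyy = −∫_Ω (v_xxy)² − ∫_Ω (v_xyy)². -/

import Mathlib

open MeasureTheory Set

/-- Partial derivative with respect to the first variable. -/
noncomputable def pdx (v : ℝ × ℝ → ℝ) : ℝ × ℝ → ℝ :=
  fun p => deriv (fun x => v (x, p.2)) p.1

/-- Partial derivative with respect to the second variable. -/
noncomputable def pdy (v : ℝ × ℝ → ℝ) : ℝ × ℝ → ℝ :=
  fun p => deriv (fun y => v (p.1, y)) p.2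


lemma hasDerivAt_pdx {v : ℝ × ℝ → ℝ} (hv : ContDiff ℝ 1 v) (x y : ℝ) :
    HasDerivAt (fun x => v (x, y)) (fderiv ℝ v (x, y) (1, 0)) x := by
  have h := (hv.differentiable one_ne_zero (x, y)).hasFDerivAt
  have h2 : HasDerivAt (fun x : ℝ => (x, y)) ((1 : ℝ), (0 : ℝ)) x :=
    (hasDerivAt_id x).prodMk (hasDerivAt_const x y)
  exact h.comp_hasDerivAt x h2

lemma hasDerivAt_pdy {v : ℝ × ℝ → ℝ} (hv : ContDiff ℝ 1 v) (x y : ℝ) :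
    HasDerivAt (fun y => v (x, y)) (fderiv ℝ v (x, y) (0, 1)) y := by
  have h := (hv.differentiable one_ne_zero (x, y)).hasFDerivAt
  have h2 : HasDerivAt (fun y : ℝ => (x, y)) ((0 : ℝ), (1 : ℝ)) y :=
    (hasDerivAt_const y x).prodMk (hasDerivAt_id y)
  exact h.comp_hasDerivAt y h2

lemma pdx_eq {v : ℝ × ℝ → ℝ} (hv : ContDiff ℝ 1 v) :
    pdx v = fun p => fderiv ℝ v p (1, 0) := by
  funext p
  exact (hasDerivAt_pdx hv p.1 p.2).deriv

lemma pdy_eq {v : ℝ × ℝ → ℝ} (hv : ContDiff ℝ 1 v) :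
    pdy v = fun p => fderiv ℝ v p (0, 1) := by
  funext p
  exact (hasDerivAt_pdy hv p.1 p.2).deriv

lemma contDiff_pdx {v : ℝ × ℝ → ℝ} (m n : ℕ) (h : m + 1 ≤ n) (hv : ContDiff ℝ n v) :
    ContDiff ℝ m (pdx v) := by
  rw [pdx_eq (hv.of_le (by exact_mod_cast (by omega : 1 ≤ n)))]
  exact (hv.fderiv_right (m := m) (by exact_mod_cast h)).clm_apply contDiff_const

lemma contDiff_pdy {v : ℝ × ℝ → ℝ} (m n : ℕ) (h : m + 1 ≤ n) (hv : ContDiff ℝ n v) :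
    ContDiff ℝ m (pdy v) := by
  rw [pdy_eq (hv.of_le (by exact_mod_cast (by omega : 1 ≤ n)))]
  exact (hv.fderiv_right (m := m) (by exact_mod_cast h)).clm_apply contDiff_const

lemma pd_comm {v : ℝ × ℝ → ℝ} (hv : ContDiff ℝ 2 v) : pdx (pdy v) = pdy (pdx v) := by
  have h1 : ContDiff ℝ 1 v := hv.of_le (by norm_num)
  have hx : ContDiff ℝ 1 (pdx v) := contDiff_pdx 1 2 le_rfl hv
  have hy : ContDiff ℝ 1 (pdy v) := contDiff_pdy 1 2 le_rfl hv
  rw [pdx_eq hy, pdy_eq hx, pdx_eq h1, pdy_eq h1]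
  funext p
  have hd : DifferentiableAt ℝ (fderiv ℝ v) p :=
    ((hv.fderiv_right (m := 1) (by norm_num)).differentiable one_ne_zero) p
  have hs := (hv.contDiffAt (x := p)).isSymmSndFDerivAt (by simp) (1, 0) (0, 1)
  rw [fderiv_clm_apply hd (differentiableAt_const _), fderiv_clm_apply hd (differentiableAt_const _)]
  simpa using hs

lemma integrableOn_rect {f : ℝ × ℝ → ℝ} (hf : Continuous f) (a b c d : ℝ) :
    IntegrableOn f (Ioo a b ×ˢ Ioo c d) :=
  (hf.continuousOn.integrableOn_compact (isCompact_Icc.prod isCompact_Icc)).mono_set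
    (prod_mono Ioo_subset_Icc_self Ioo_subset_Icc_self)

lemma ibp1 {a b : ℝ} (hab : a < b) (f f' f'' : ℝ → ℝ) (h1 : ∀ x, HasDerivAt f (f' x) x)
    (h2 : ∀ x, HasDerivAt f' (f'' x) x) (hc : Continuous f'') (ha : f a = 0) (hb : f b = 0) :
    ∫ x in Ioo a b, f x * f'' x = ∫ x in Ioo a b, -(f' x) ^ 2 := by
  rw [← integral_Ioc_eq_integral_Ioo, ← integral_Ioc_eq_integral_Ioo,
    ← intervalIntegral.integral_of_le hab.le, ← intervalIntegral.integral_of_le hab.le]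
  have hc' : Continuous f' := continuous_iff_continuousAt.2 fun x => (h2 x).continuousAt
  rw [intervalIntegral.integral_mul_deriv_eq_deriv_mul (fun x _ => h1 x) (fun x _ => h2 x)
    (hc'.intervalIntegrable _ _) (hc.intervalIntegrable _ _), ha, hb]
  simp [sq]

lemma ibp_y {a b c d : ℝ} (hcd : c < d) {u : ℝ × ℝ → ℝ} (hu : ContDiff ℝ 2 u)
    (h0 : ∀ x ∈ Ioo a b, u (x, c) = 0 ∧ u (x, d) = 0) :
    ∫ p in Ioo a b ×ˢ Ioo c d, u p * pdy (pdy u) p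
      = -∫ p in Ioo a b ×ˢ Ioo c d, (pdy u p) ^ 2 := by
  have h1 : ContDiff ℝ 1 u := hu.of_le (by norm_num)
  have hy : ContDiff ℝ 1 (pdy u) := contDiff_pdy 1 2 le_rfl hu
  have hyy : Continuous (pdy (pdy u)) := (contDiff_pdy 0 1 le_rfl hy).continuous
  rw [← integral_neg, Measure.volume_eq_prod]
  refine (setIntegral_prod _ (integrableOn_rect (hu.continuous.mul hyy) a b c d)).trans
    (Eq.trans ?_ (setIntegral_prod _ (integrableOn_rect (hy.continuous.pow 2).neg a b c d)).symm)
  refine setIntegral_congr_fun measurableSet_Ioo fun x hx => ?_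
  refine ibp1 hcd (fun y => u (x, y)) (fun y => pdy u (x, y)) (fun y => pdy (pdy u) (x, y))
    (fun y => ?_) (fun y => ?_) (by fun_prop) (h0 x hx).1 (h0 x hx).2
  · simpa only [pdy_eq h1] using hasDerivAt_pdy h1 x y
  · rw [pdy_eq hy]; exact hasDerivAt_pdy hy x y

lemma ibp_x {a b c d : ℝ} (hab : a < b) {u : ℝ × ℝ → ℝ} (hu : ContDiff ℝ 2 u)
    (h0 : ∀ y ∈ Ioo c d, u (a, y) = 0 ∧ u (b, y) = 0) :
    ∫ p in Ioo a b ×ˢ Ioo c d, u p * pdx (pdx u) p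
      = -∫ p in Ioo a b ×ˢ Ioo c d, (pdx u p) ^ 2 := by
  have h1 : ContDiff ℝ 1 u := hu.of_le (by norm_num)
  have hx : ContDiff ℝ 1 (pdx u) := contDiff_pdx 1 2 le_rfl hu
  have hxx : Continuous (pdx (pdx u)) := (contDiff_pdx 0 1 le_rfl hx).continuous
  have hi1 := integrableOn_rect (hu.continuous.mul hxx) a b c d
  have hi2 := integrableOn_rect (hx.continuous.pow 2).neg a b c d
  rw [IntegrableOn, Measure.volume_eq_prod, ← Measure.prod_restrict] at hi1 hi2
  rw [← integral_neg, Measure.volume_eq_prod, ← Measure.prod_restrict]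
  refine (integral_prod_symm _ hi1).trans (Eq.trans ?_ (integral_prod_symm _ hi2).symm)
  refine setIntegral_congr_fun measurableSet_Ioo fun y hy => ?_
  refine ibp1 hab (fun x => u (x, y)) (fun x => pdx u (x, y)) (fun x => pdx (pdx u) (x, y))
    (fun x => ?_) (fun x => ?_) (by fun_prop) (h0 y hy).1 (h0 y hy).2
  · simpa only [pdx_eq h1] using hasDerivAt_pdx h1 x y
  · rw [pdx_eq hx]; exact hasDerivAt_pdx hx x y

lemma deriv_zero_Ioo {f : ℝ → ℝ} {a b : ℝ} (h : ∀ x ∈ Ioo a b, f x = 0) :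
    ∀ x ∈ Ioo a b, deriv f x = 0 := by
  intro x hx
  have : f =ᶠ[nhds x] fun _ => 0 := by
    filter_upwards [isOpen_Ioo.mem_nhds hx] with z hz using h z hz
  rw [this.deriv_eq]; simp

lemma pdxx_zero {v : ℝ × ℝ → ℝ} {a b y : ℝ} (h : ∀ x ∈ Ioo a b, v (x, y) = 0) :
    ∀ x ∈ Ioo a b, pdx (pdx v) (x, y) = 0 :=
  deriv_zero_Ioo (f := fun x => pdx v (x, y)) (deriv_zero_Ioo (f := fun x => v (x, y)) h)

lemma pdyy_zero {v : ℝ × ℝ → ℝ} {c d x : ℝ} (h : ∀ y ∈ Ioo c d, v (x, y) = 0) :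
    ∀ y ∈ Ioo c d, pdy (pdy v) (x, y) = 0 :=
  deriv_zero_Ioo (f := fun y => pdy v (x, y)) (deriv_zero_Ioo (f := fun y => v (x, y)) h)

theorem stmt_2 (a b c d : ℝ) (hab : a < b) (hcd : c < d)
    (v : ℝ × ℝ → ℝ) (hv : ContDiff ℝ 4 v)
    (hbc1 : ∀ x ∈ Icc a b, v (x, c) = 0 ∧ v (x, d) = 0)
    (hbc2 : ∀ y ∈ Icc c d, v (a, y) = 0 ∧ v (b, y) = 0) :
    (∫ p in (Ioo a b) ×ˢ (Ioo c d),
        (pdx (pdx v) p + pdy (pdy v) p) * pdx (pdx (pdy (pdy v))) p) =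
      -(∫ p in (Ioo a b) ×ˢ (Ioo c d), (pdx (pdx (pdy v)) p) ^ 2) -
        ∫ p in (Ioo a b) ×ˢ (Ioo c d), (pdx (pdy (pdy v)) p) ^ 2 := by
  have hx : ContDiff ℝ 3 (pdx v) := contDiff_pdx 3 4 le_rfl hv
  have hy : ContDiff ℝ 3 (pdy v) := contDiff_pdy 3 4 le_rfl hv
  have hxx : ContDiff ℝ 2 (pdx (pdx v)) := contDiff_pdx 2 3 le_rfl hx
  have hyy : ContDiff ℝ 2 (pdy (pdy v)) := contDiff_pdy 2 3 le_rfl hy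
  have hxy : ContDiff ℝ 2 (pdx (pdy v)) := contDiff_pdx 2 3 le_rfl hy
  have hc : Continuous (pdx (pdx (pdy (pdy v)))) :=
    (contDiff_pdx 0 1 le_rfl (contDiff_pdx 1 2 le_rfl hyy)).continuous
  have e1 : pdx (pdx (pdy v)) = pdy (pdx (pdx v)) := by
    rw [pd_comm (hv.of_le (by norm_num)), pd_comm (hx.of_le (by norm_num))]
  have e2 : pdx (pdx (pdy (pdy v))) = pdy (pdy (pdx (pdx v))) := by
    rw [← e1, pd_comm (hy.of_le (by norm_num)), pd_comm hxy]
  have A := ibp_y (a := a) (b := b) hcd hxx fun x hx' =>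
    ⟨pdxx_zero (fun x hx => (hbc1 x (Ioo_subset_Icc_self hx)).1) x hx',
      pdxx_zero (fun x hx => (hbc1 x (Ioo_subset_Icc_self hx)).2) x hx'⟩
  have B := ibp_x (c := c) (d := d) hab hyy fun y hy' =>
    ⟨pdyy_zero (fun y hy => (hbc2 y (Ioo_subset_Icc_self hy)).1) y hy',
      pdyy_zero (fun y hy => (hbc2 y (Ioo_subset_Icc_self hy)).2) y hy'⟩
  rw [← e2, ← e1] at A
  simp only [add_mul]
  refine (integral_add (integrableOn_rect (hxx.continuous.mul hc) a b c d)
    (integrableOn_rect (hyy.continuous.mul hc) a b c d)).trans ?_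
  simp only [Pi.mul_apply]
  rw [A, B]
  ring
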